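/- arXiv:1702.00466 — 3 statements merged into one kernel-verified Lean document; each statement's English description precedes it below -/
import Mathlib

section
/- There exists a unique Borel probability measure μ_a ∈ M_a such that I[μ_a] = inf_{μ ∈ M_a} I[μ]; moreover this infimum is finite (strictly between −∞ and +∞). -/
open MeasureTheory Real
open scoped ENNReal RealInnerProductSpace

abbrev Plane : Type := EuclideanSpace ℝ (Fin 2)

noncomputable def logKernel (x y : Plane) : ℝ := Real.log (1 / dist x y)

open Classical in
noncomputable def wKernel (x y : Plane) : ℝ≥0∞ :=
  if x = y then ⊤ else ENNReal.ofReal (logKernel x y + (‖x‖ ^ 2 + ‖y‖ ^ 2) / 2 + 1)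

noncomputable def wEnergy (μ : Measure Plane) : ℝ≥0∞ :=
  ∫⁻ p : Plane × Plane, wKernel p.1 p.2 ∂(μ.prod μ)

def Ma (Γ : Set Plane) (a : ℝ) : Set (Measure Plane) :=
  {μ | IsProbabilityMeasure μ ∧ ENNReal.ofReal a ≤ μ Γ}

structure RegularCurve (γ : ℝ → Plane) (Γ : Set Plane) : Prop where
  injective : Function.Injective γ
  image : Γ = Set.range γ
  closed : IsClosed Γ
  contDiff : ContDiff ℝ 1 γ
  unitSpeed : ∀ t, ‖deriv γ t‖ = 1
  holder : ∃ α : ℝ, α ∈ Set.Ioc (0:ℝ) 1 ∧ ∃ M : ℝ, 0 ≤ M ∧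
    ∀ s t : ℝ, ‖deriv γ t - deriv γ s‖ ≤ M * |t - s| ^ α

/-- The logarithmic kernel regularized by `ε`, with the external field. -/
noncomputable def regKernel (ε : ℝ) (p : Plane × Plane) : ℝ :=
  1 + (‖p.1‖ ^ 2 + ‖p.2‖ ^ 2) / 2 - Real.log (dist p.1 p.2 ^ 2 + ε) / 2

lemma log_le_half {y : ℝ} (hy : 0 < y) : Real.log y ≤ y / 2 := by
  have h := Real.log_le_sub_one_of_pos (half_pos hy)
  rw [Real.log_div hy.ne' two_ne_zero] at h
  have := Real.log_le_sub_one_of_pos (zero_lt_two (α := ℝ))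
  linarith

lemma dist_sq_le_two_mul (x y : Plane) : dist x y ^ 2 ≤ 2 * (‖x‖ ^ 2 + ‖y‖ ^ 2) := by
  have h : dist x y ≤ ‖x‖ + ‖y‖ := dist_le_norm_add_norm x y
  nlinarith [sq_nonneg (‖x‖ - ‖y‖), dist_nonneg (x := x) (y := y), norm_nonneg x, norm_nonneg y]

lemma continuous_regKernel {ε : ℝ} (hε : 0 < ε) : Continuous (regKernel ε) := by
  unfold regKernel
  have h : ∀ p : Plane × Plane, dist p.1 p.2 ^ 2 + ε ≠ 0 := fun p => by positivity
  fun_prop (disch := assumption)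

lemma regKernel_nonneg {ε : ℝ} (hε : 0 < ε) (hε1 : ε ≤ 1) (p : Plane × Plane) :
    0 ≤ regKernel ε p := by
  have h := log_le_half (y := dist p.1 p.2 ^ 2 + ε) (by positivity)
  have := dist_sq_le_two_mul p.1 p.2
  unfold regKernel
  linarith

lemma regKernel_anti {ε δ : ℝ} (hε : 0 < ε) (h : ε ≤ δ) (p : Plane × Plane) :
    regKernel δ p ≤ regKernel ε p := by
  have := Real.log_le_log (x := dist p.1 p.2 ^ 2 + ε) (by positivity)
    (add_le_add_right h (dist p.1 p.2 ^ 2))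
  unfold regKernel
  linarith

lemma wKernel_of_ne {x y : Plane} (h : x ≠ y) :
    wKernel x y = ENNReal.ofReal
      (1 + (‖x‖ ^ 2 + ‖y‖ ^ 2) / 2 - Real.log (dist x y ^ 2) / 2) := by
  rw [wKernel, if_neg h, logKernel, one_div, Real.log_inv, Real.log_pow]
  congr 1
  push_cast
  ring

lemma wKernel_comm (x y : Plane) : wKernel x y = wKernel y x := by
  by_cases h : x = y
  · rw [h]
  · rw [wKernel_of_ne h, wKernel_of_ne (Ne.symm h), dist_comm, add_comm (‖x‖ ^ 2)]

lemma monotone_regKernel (p : Plane × Plane) :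
    Monotone fun n : ℕ => ENNReal.ofReal (regKernel (1 / ((n : ℝ) + 1)) p) := by
  intro m n hmn
  exact ENNReal.ofReal_le_ofReal
    (regKernel_anti (by positivity) (one_div_le_one_div_of_le (by positivity)
      (by have : (m : ℝ) ≤ n := by exact_mod_cast hmn
          linarith)) p)

lemma iSup_regKernel (p : Plane × Plane) :
    ⨆ n : ℕ, ENNReal.ofReal (regKernel (1 / ((n : ℝ) + 1)) p) = wKernel p.1 p.2 := by
  refine iSup_eq_of_tendsto (monotone_regKernel p) ?_
  have hlim := tendsto_one_div_add_atTop_nhds_zero_nat (𝕜 := ℝ)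
  by_cases h : p.1 = p.2
  · rw [wKernel, if_pos h]
    refine ENNReal.tendsto_ofReal_nhds_top.2 ?_
    have h1 : Filter.Tendsto (fun n : ℕ => Real.log (1 / ((n : ℝ) + 1))) Filter.atTop
        Filter.atBot :=
      Real.tendsto_log_nhdsGT_zero.comp (tendsto_nhdsWithin_iff.2
        ⟨hlim, Filter.Eventually.of_forall fun n => by
          rw [Set.mem_Ioi]; positivity⟩)
    simp only [regKernel, h, dist_self, ne_eq, OfNat.ofNat_ne_zero, not_false_eq_true, zero_pow,
      zero_add, sub_eq_add_neg]
    refine Filter.tendsto_atTop_add_const_left _ _ ?_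
    exact Filter.tendsto_neg_atBot_atTop.comp (h1.atBot_div_const two_pos)
  · rw [wKernel_of_ne h]
    refine ENNReal.tendsto_ofReal ?_
    have hd : dist p.1 p.2 ^ 2 ≠ 0 := by simpa using h
    have h2 : Filter.Tendsto (fun n : ℕ => dist p.1 p.2 ^ 2 + 1 / ((n : ℝ) + 1)) Filter.atTop
        (nhds (dist p.1 p.2 ^ 2)) := by
      simpa using hlim.const_add (dist p.1 p.2 ^ 2)
    exact ((h2.log hd).div_const 2).const_sub _

lemma measurable_wKernel : Measurable fun p : Plane × Plane => wKernel p.1 p.2 := by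
  simp_rw [← iSup_regKernel]
  exact Measurable.iSup fun n =>
    (continuous_regKernel (by positivity)).measurable.ennreal_ofReal

lemma lintegral_wKernel_eq_iSup (ρ : Measure (Plane × Plane)) :
    ∫⁻ p, wKernel p.1 p.2 ∂ρ =
      ⨆ n : ℕ, ∫⁻ p, ENNReal.ofReal (regKernel (1 / ((n : ℝ) + 1)) p) ∂ρ := by
  simp_rw [← iSup_regKernel]
  exact lintegral_iSup
    (fun n => (continuous_regKernel (by positivity)).measurable.ennreal_ofReal)
    (fun m n hmn p => monotone_regKernel p hmn)

lemma norm_sq_le_wKernel (x y : Plane) :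
    ENNReal.ofReal (‖x‖ ^ 2 / 4) ≤ wKernel x y := by
  by_cases h : x = y
  · rw [wKernel, if_pos h]; exact le_top
  rw [wKernel_of_ne h]
  refine ENNReal.ofReal_le_ofReal ?_
  have hpos : 0 < dist x y ^ 2 := by have := dist_pos.2 h; positivity
  have h1 := log_le_half (y := dist x y ^ 2 / 2) (by positivity)
  rw [Real.log_div hpos.ne' two_ne_zero] at h1
  have h2 := Real.log_le_sub_one_of_pos (zero_lt_two (α := ℝ))
  have h3 := dist_sq_le_two_mul x y
  nlinarith [sq_nonneg ‖y‖]

lemma lintegral_norm_sq_le_wEnergy (μ : Measure Plane) [IsProbabilityMeasure μ] :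
    ∫⁻ x, ENNReal.ofReal (‖x‖ ^ 2 / 4) ∂μ ≤ wEnergy μ := by
  rw [wEnergy, lintegral_prod _ measurable_wKernel.aemeasurable]
  refine lintegral_mono fun x => ?_
  calc ENNReal.ofReal (‖x‖ ^ 2 / 4) = ∫⁻ _ : Plane, ENNReal.ofReal (‖x‖ ^ 2 / 4) ∂μ := by simp
    _ ≤ _ := lintegral_mono fun y => norm_sq_le_wKernel x y

lemma wEnergy_le_liminf {μ : ProbabilityMeasure Plane} {μs : ℕ → ProbabilityMeasure Plane}
    (h : Filter.Tendsto μs Filter.atTop (nhds μ)) :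
    wEnergy (μ : Measure Plane) ≤
      Filter.atTop.liminf fun n => wEnergy (μs n : Measure Plane) := by
  rw [wEnergy, lintegral_wKernel_eq_iSup]
  refine iSup_le fun k => ?_
  have hk : (0 : ℝ) < 1 / ((k : ℝ) + 1) := by positivity
  have hk1 : 1 / ((k : ℝ) + 1) ≤ 1 := by
    rw [div_le_one (by positivity)]
    linarith [Nat.cast_nonneg (α := ℝ) k]
  have hprod : Filter.Tendsto (fun n => (μs n).prod (μs n)) Filter.atTop (nhds (μ.prod μ)) :=
    (ProbabilityMeasure.continuous_prod.tendsto (μ, μ)).comp (h.prodMk_nhds h)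
  refine (lintegral_le_liminf_lintegral_of_forall_isOpen_measure_le_liminf_measure
    (μ := (μ.prod μ : ProbabilityMeasure _).toMeasure)
    (μs := fun n => ((μs n).prod (μs n)).toMeasure)
    (continuous_regKernel hk) (regKernel_nonneg hk hk1)
    fun G hG => ProbabilityMeasure.le_liminf_measure_open_of_tendsto hprod hG).trans ?_
  refine Filter.liminf_le_liminf (Filter.Eventually.of_forall fun n => ?_)
  rw [wEnergy]
  refine lintegral_mono fun p => ?_
  rw [← iSup_regKernel]
  exact le_iSup (fun n : ℕ => ENNReal.ofReal (regKernel (1 / ((n : ℝ) + 1)) p)) k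

/-- The Gaussian interaction of two measures. -/
noncomputable def gaussEnergy (t : ℝ) (μ ν : Measure Plane) : ℝ :=
  ∫ p : Plane × Plane, Real.exp (-(t * dist p.1 p.2 ^ 2)) ∂(μ.prod ν)

lemma integrable_gauss {t : ℝ} (ht : 0 ≤ t) (ρ : Measure (Plane × Plane)) [IsFiniteMeasure ρ] :
    Integrable (fun p : Plane × Plane => Real.exp (-(t * dist p.1 p.2 ^ 2))) ρ := by
  refine Integrable.of_bound (C := 1) ?_ (Filter.Eventually.of_forall fun p => ?_)
  · exact (by fun_prop : Continuous fun p : Plane × Plane =>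
      Real.exp (-(t * dist p.1 p.2 ^ 2))).aestronglyMeasurable
  · rw [Real.norm_eq_abs, Real.abs_exp, Real.exp_le_one_iff, neg_nonpos]
    positivity

lemma continuous_charFun_of_isFiniteMeasure (μ : Measure Plane) [IsFiniteMeasure μ] :
    Continuous (charFun μ) := by
  unfold charFun
  refine continuous_of_dominated (bound := fun _ => 1) (fun t => ?_) (fun t => ?_)
    (integrable_const _) (Filter.Eventually.of_forall fun x => by fun_prop)
  · exact (by fun_prop : Continuous fun x : Plane =>
      Complex.exp (⟪x, t⟫ * Complex.I)).aestronglyMeasurable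
  · exact Filter.Eventually.of_forall fun x => (Complex.norm_exp_ofReal_mul_I _).le

lemma integrable_exp_neg_mul_sq_norm_plane {b : ℝ} (hb : 0 < b) :
    Integrable fun v : Plane => Real.exp (-b * ‖v‖ ^ 2) := by
  have := GaussianFourier.integrable_cexp_neg_mul_sq_norm_add (V := Plane)
    (b := (b : ℂ)) (by rwa [Complex.ofReal_re]) 0 0
  refine this.norm.congr (Filter.Eventually.of_forall fun v => ?_)
  simp only [zero_mul, add_zero, Complex.norm_exp]
  norm_cast

lemma gauss_eq_fourier {t : ℝ} (ht : 0 < t) (w : Plane) :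
    (Real.exp (-(t * ‖w‖ ^ 2)) : ℂ) = (4 * t * π : ℝ)⁻¹ •
      ∫ v : Plane, (Real.exp (-(4 * t)⁻¹ * ‖v‖ ^ 2) : ℂ) * Complex.exp (⟪w, v⟫ * Complex.I) := by
  have h := GaussianFourier.integral_cexp_neg_mul_sq_norm_add (V := Plane)
    (b := (((4 * t)⁻¹ : ℝ) : ℂ)) (by rw [Complex.ofReal_re]; positivity) Complex.I w
  have h2 : ∀ v : Plane, (Real.exp (-(4 * t)⁻¹ * ‖v‖ ^ 2) : ℂ) *
      Complex.exp (⟪w, v⟫ * Complex.I) =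
      Complex.exp (-(((4 * t)⁻¹ : ℝ) : ℂ) * ‖v‖ ^ 2 + Complex.I * ⟪w, v⟫) := by
    intro v
    rw [Complex.ofReal_exp, ← Complex.exp_add]
    push_cast
    ring_nf
  simp_rw [h2]
  rw [h, finrank_euclideanSpace_fin, Complex.real_smul]
  have ht' : (t : ℂ) ≠ 0 := by exact_mod_cast ht.ne'
  have hpi : (π : ℂ) ≠ 0 := by exact_mod_cast Real.pi_ne_zero
  rw [Complex.I_sq]
  norm_num
  rw [← mul_assoc]
  field_simp

lemma gaussEnergy_eq {t : ℝ} (ht : 0 < t) (μ ν : Measure Plane) [IsProbabilityMeasure μ]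
    [IsProbabilityMeasure ν] :
    (gaussEnergy t μ ν : ℂ) = (4 * t * π : ℝ)⁻¹ •
      ∫ v : Plane, (Real.exp (-(4 * t)⁻¹ * ‖v‖ ^ 2) : ℂ) *
        (charFun μ v * (starRingEnd ℂ) (charFun ν v)) := by
  have hInt := integrable_exp_neg_mul_sq_norm_plane (b := (4 * t)⁻¹) (by positivity)
  rw [gaussEnergy, ← integral_complex_ofReal]
  simp_rw [dist_eq_norm, gauss_eq_fourier ht]
  rw [integral_smul, integral_integral_swap]
  · congr 2
    ext v
    rw [integral_const_mul]
    congr 1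
    rw [← charFun_neg, charFun_apply, charFun_apply, ← integral_prod_mul]
    congr 1
    ext p
    rw [← Complex.exp_add, inner_sub_left, inner_neg_right]
    push_cast
    ring_nf
  · refine Integrable.mono' (hInt.comp_snd (μ.prod ν)) ?_
      (Filter.Eventually.of_forall fun q => ?_)
    · refine Continuous.aestronglyMeasurable ?_
      simp only [Function.uncurry_def]
      fun_prop
    · simp only [Function.uncurry_def]
      rw [norm_mul, Complex.norm_exp_ofReal_mul_I, mul_one, Complex.norm_real, Real.norm_eq_abs,
        Real.abs_exp]

lemma gaussEnergy_sub {t : ℝ} (ht : 0 < t) (μ ν : Measure Plane) [IsProbabilityMeasure μ]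
    [IsProbabilityMeasure ν] :
    gaussEnergy t μ μ + gaussEnergy t ν ν - 2 * gaussEnergy t μ ν = (4 * t * π)⁻¹ *
      ∫ v : Plane, Real.exp (-(4 * t)⁻¹ * ‖v‖ ^ 2) * ‖charFun μ v - charFun ν v‖ ^ 2 := by
  have hInt := integrable_exp_neg_mul_sq_norm_plane (b := (4 * t)⁻¹) (by positivity)
  have hre : ∀ μ ν : Measure Plane, IsProbabilityMeasure μ → IsProbabilityMeasure ν →
      Integrable (fun v : Plane => Real.exp (-(4 * t)⁻¹ * ‖v‖ ^ 2) *
        (charFun μ v * (starRingEnd ℂ) (charFun ν v)).re) ∧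
      gaussEnergy t μ ν = (4 * t * π)⁻¹ *
      ∫ v : Plane, Real.exp (-(4 * t)⁻¹ * ‖v‖ ^ 2) *
        (charFun μ v * (starRingEnd ℂ) (charFun ν v)).re := by
    intro μ ν _ _
    have hμ := continuous_charFun_of_isFiniteMeasure μ
    have hν := continuous_charFun_of_isFiniteMeasure ν
    have hI : Integrable (fun v : Plane => (Real.exp (-(4 * t)⁻¹ * ‖v‖ ^ 2) : ℂ) *
        (charFun μ v * (starRingEnd ℂ) (charFun ν v))) := by
      refine Integrable.mono' hInt ?_ (Filter.Eventually.of_forall fun v => ?_)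
      · exact (by fun_prop : Continuous fun v : Plane => (Real.exp (-(4 * t)⁻¹ * ‖v‖ ^ 2) : ℂ) *
          (charFun μ v * (starRingEnd ℂ) (charFun ν v))).aestronglyMeasurable
      · rw [norm_mul, norm_mul, Complex.norm_real, Real.norm_eq_abs, Real.abs_exp,
          RCLike.norm_conj]
        refine mul_le_of_le_one_right (Real.exp_nonneg _) ?_
        exact mul_le_one₀ (norm_charFun_le_one v) (norm_nonneg _) (norm_charFun_le_one v)
    refine ⟨hI.re.congr (Filter.Eventually.of_forall fun v => ?_), ?_⟩
    · exact Complex.re_ofReal_mul _ _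
    · have h := congrArg Complex.re (gaussEnergy_eq ht μ ν)
      rw [Complex.ofReal_re, Complex.smul_re, smul_eq_mul] at h
      rw [h]
      congr 1
      refine (integral_re hI).symm.trans (integral_congr_ae (Filter.Eventually.of_forall fun v => ?_))
      exact Complex.re_ofReal_mul _ _
  obtain ⟨i1, e1⟩ := hre μ μ inferInstance inferInstance
  obtain ⟨i2, e2⟩ := hre ν ν inferInstance inferInstance
  obtain ⟨i3, e3⟩ := hre μ ν inferInstance inferInstance
  have i12 := i1.add i2
  simp only [Pi.add_def] at i12
  rw [e1, e2, e3, ← mul_add, mul_left_comm 2, ← mul_sub, ← integral_add i1 i2,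
    ← integral_const_mul, ← integral_sub i12 (i3.const_mul 2)]
  congr 2
  ext v
  rw [← Complex.normSq_eq_norm_sq, Complex.normSq_sub, Complex.mul_conj, Complex.mul_conj,
    Complex.ofReal_re, Complex.ofReal_re]
  ring

lemma gaussEnergy_sub_nonneg {t : ℝ} (ht : 0 < t) (μ ν : Measure Plane) [IsProbabilityMeasure μ]
    [IsProbabilityMeasure ν] :
    0 ≤ gaussEnergy t μ μ + gaussEnergy t ν ν - 2 * gaussEnergy t μ ν := by
  rw [gaussEnergy_sub ht]
  exact mul_nonneg (by positivity) (integral_nonneg fun v => by positivity)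

lemma eq_of_gaussEnergy_sub_nonpos {t : ℝ} (ht : 0 < t) (μ ν : Measure Plane)
    [IsProbabilityMeasure μ] [IsProbabilityMeasure ν]
    (h : gaussEnergy t μ μ + gaussEnergy t ν ν - 2 * gaussEnergy t μ ν ≤ 0) : μ = ν := by
  have h0 := le_antisymm h (gaussEnergy_sub_nonneg ht μ ν)
  rw [gaussEnergy_sub ht, mul_eq_zero_iff_left (by positivity)] at h0
  have hμ := continuous_charFun_of_isFiniteMeasure μ
  have hν := continuous_charFun_of_isFiniteMeasure ν
  have hc : Continuous fun v : Plane =>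
      Real.exp (-(4 * t)⁻¹ * ‖v‖ ^ 2) * ‖charFun μ v - charFun ν v‖ ^ 2 := by fun_prop
  have hInt : Integrable fun v : Plane =>
      Real.exp (-(4 * t)⁻¹ * ‖v‖ ^ 2) * ‖charFun μ v - charFun ν v‖ ^ 2 := by
    refine Integrable.mono' ((integrable_exp_neg_mul_sq_norm_plane (b := (4 * t)⁻¹)
      (by positivity)).mul_const 4) hc.aestronglyMeasurable
      (Filter.Eventually.of_forall fun v => ?_)
    rw [Real.norm_of_nonneg (by positivity)]
    have h1 := norm_sub_le (charFun μ v) (charFun ν v)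
    have h2 := norm_charFun_le_one (μ := μ) v
    have h3 := norm_charFun_le_one (μ := ν) v
    gcongr
    nlinarith [norm_nonneg (charFun μ v - charFun ν v)]
  rw [integral_eq_zero_iff_of_nonneg (fun v => by positivity) hInt] at h0
  have h1 := (hc.ae_eq_iff_eq volume continuous_const).1 h0
  refine Measure.ext_of_charFun (funext fun v => ?_)
  have h2 : Real.exp (-(4 * t)⁻¹ * ‖v‖ ^ 2) * ‖charFun μ v - charFun ν v‖ ^ 2 = 0 :=
    congrFun h1 v
  simpa [sub_eq_zero] using h2

lemma lintegral_frullani {ε u : ℝ} (hε : 0 < ε) (hu : 0 ≤ u) :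
    ∫⁻ t in Set.Ioi (0 : ℝ), ENNReal.ofReal
        ((1 - Real.exp (-(t * u))) * (Real.exp (-(t * ε)) / (2 * t))) =
      ENNReal.ofReal ((Real.log (u + ε) - Real.log ε) / 2) := by
  set f : ℝ → ℝ := fun x => Real.exp (-x)
  have hf : Continuous f := by fun_prop
  have heq : ∀ t : ℝ, t⁻¹ • (f (ε * t) - f ((u + ε) * t)) =
      2 * ((1 - Real.exp (-(t * u))) * (Real.exp (-(t * ε)) / (2 * t))) := by
    intro t
    simp only [f, smul_eq_mul]
    rw [show -((u + ε) * t) = -(t * u) + -(t * ε) by ring, Real.exp_add, mul_comm ε t]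
    ring
  have hnn : ∀ t ∈ Set.Ioi (0 : ℝ),
      0 ≤ (1 - Real.exp (-(t * u))) * (Real.exp (-(t * ε)) / (2 * t)) := by
    intro t ht
    rw [Set.mem_Ioi] at ht
    have : Real.exp (-(t * u)) ≤ 1 := Real.exp_le_one_iff.2 (by rw [neg_nonpos]; positivity)
    exact mul_nonneg (by linarith) (by positivity)
  have hInt : IntegrableOn (fun t : ℝ => t⁻¹ • (f (ε * t) - f ((u + ε) * t))) (Set.Ioi 0) := by
    have hb : IntegrableOn (fun t : ℝ => u * Real.exp (-ε * t)) (Set.Ioi 0) :=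
      (exp_neg_integrableOn_Ioi 0 hε).const_mul u
    refine Integrable.mono' hb (by fun_prop) ?_
    filter_upwards [ae_restrict_mem measurableSet_Ioi] with t ht
    rw [heq, Real.norm_of_nonneg (mul_nonneg zero_le_two (hnn t ht))]
    rw [Set.mem_Ioi] at ht
    have h1 := Real.add_one_le_exp (-(t * u))
    calc 2 * ((1 - Real.exp (-(t * u))) * (Real.exp (-(t * ε)) / (2 * t)))
        ≤ 2 * ((t * u) * (Real.exp (-(t * ε)) / (2 * t))) := by
          gcongr; linarith
      _ = u * Real.exp (-ε * t) := by
          rw [show -ε * t = -(t * ε) by ring]; field_simp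
  have hF := Frullani.integral_Ioi_eq (f := f) (a := ε) (b := u + ε) (L := 1) (R := 0)
    (hf.locallyIntegrable.locallyIntegrableOn _) hε (by linarith)
    (by simpa [f] using (hf.tendsto 0).mono_left nhdsWithin_le_nhds)
    Real.tendsto_exp_neg_atTop_nhds_zero hInt
  simp_rw [heq] at hF hInt
  have hInt' : IntegrableOn (fun t : ℝ =>
      (1 - Real.exp (-(t * u))) * (Real.exp (-(t * ε)) / (2 * t))) (Set.Ioi 0) := by
    simpa [IntegrableOn] using hInt.const_mul (1 / 2)
  rw [← ofReal_integral_eq_lintegral_ofReal hInt'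
    ((ae_restrict_mem measurableSet_Ioi).mono hnn)]
  rw [integral_const_mul, Real.log_div (by linarith) hε.ne'] at hF
  congr 1
  simp at hF
  linarith

/-- The part of the interaction energy that the regularization at scale `ε` subtracts. -/
noncomputable def logDefect (ε : ℝ) (μ ν : Measure Plane) : ℝ≥0∞ :=
  ∫⁻ p : Plane × Plane,
    ENNReal.ofReal ((Real.log (dist p.1 p.2 ^ 2 + ε) - Real.log ε) / 2) ∂(μ.prod ν)

lemma measurable_gaussEnergy (μ ν : Measure Plane) [IsProbabilityMeasure μ]
    [IsProbabilityMeasure ν] : Measurable fun t => gaussEnergy t μ ν := by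
  unfold gaussEnergy
  have h : StronglyMeasurable (Function.uncurry fun (t : ℝ) (p : Plane × Plane) =>
      Real.exp (-(t * dist p.1 p.2 ^ 2))) := by
    refine Continuous.stronglyMeasurable ?_
    simp only [Function.uncurry_def]
    fun_prop
  exact h.integral_prod_right.measurable

lemma gaussEnergy_le_one {t : ℝ} (ht : 0 ≤ t) (μ ν : Measure Plane) [IsProbabilityMeasure μ]
    [IsProbabilityMeasure ν] : gaussEnergy t μ ν ≤ 1 := by
  unfold gaussEnergy
  calc _ ≤ ∫ _ : Plane × Plane, (1 : ℝ) ∂(μ.prod ν) := by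
        refine integral_mono (integrable_gauss ht _) (integrable_const _) fun p => ?_
        rw [Real.exp_le_one_iff, neg_nonpos]
        positivity
    _ = 1 := by simp

lemma logDefect_eq {ε : ℝ} (hε : 0 < ε) (μ ν : Measure Plane) [IsProbabilityMeasure μ]
    [IsProbabilityMeasure ν] :
    logDefect ε μ ν = ∫⁻ t in Set.Ioi (0 : ℝ),
      ENNReal.ofReal ((1 - gaussEnergy t μ ν) * (Real.exp (-(t * ε)) / (2 * t))) := by
  unfold logDefect
  simp_rw [← lintegral_frullani hε (sq_nonneg (dist _ _))]
  rw [lintegral_lintegral_swap]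
  · refine setLIntegral_congr_fun measurableSet_Ioi fun t ht => ?_
    rw [Set.mem_Ioi] at ht
    have hI := (integrable_const (1 : ℝ)).sub (integrable_gauss ht.le (μ.prod ν))
    have hI' := hI.mul_const (Real.exp (-(t * ε)) / (2 * t))
    simp only [Pi.sub_apply] at hI'
    rw [← ofReal_integral_eq_lintegral_ofReal hI', integral_mul_const, integral_sub
      (integrable_const _) (integrable_gauss ht.le _)]
    · simp [gaussEnergy]
    · refine Filter.Eventually.of_forall fun p => ?_
      have : Real.exp (-(t * dist p.1 p.2 ^ 2)) ≤ 1 :=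
        Real.exp_le_one_iff.2 (by rw [neg_nonpos]; positivity)
      exact mul_nonneg (by linarith) (by positivity)
  · refine Measurable.aemeasurable ?_
    simp only [Function.uncurry_def]
    fun_prop

lemma logDefect_add {ε : ℝ} (hε : 0 < ε) (μ ν : Measure Plane) [IsProbabilityMeasure μ]
    [IsProbabilityMeasure ν] :
    logDefect ε μ μ + logDefect ε ν ν + ∫⁻ t in Set.Ioi (0 : ℝ), ENNReal.ofReal
      ((gaussEnergy t μ μ + gaussEnergy t ν ν - 2 * gaussEnergy t μ ν) *
        (Real.exp (-(t * ε)) / (2 * t))) = 2 * logDefect ε μ ν := by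
  have m1 := measurable_gaussEnergy μ μ
  have m2 := measurable_gaussEnergy ν ν
  have m3 := measurable_gaussEnergy μ ν
  rw [logDefect_eq hε, logDefect_eq hε, logDefect_eq hε, ← lintegral_add_left (by fun_prop),
    ← lintegral_add_left (by fun_prop), ← lintegral_const_mul _ (by fun_prop)]
  refine setLIntegral_congr_fun measurableSet_Ioi fun t ht => ?_
  rw [Set.mem_Ioi] at ht
  have h1 := gaussEnergy_le_one ht.le μ μ
  have h2 := gaussEnergy_le_one ht.le ν ν
  have h3 := gaussEnergy_le_one ht.le μ ν
  have h4 := gaussEnergy_sub_nonneg ht μ ν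
  have hw : 0 ≤ Real.exp (-(t * ε)) / (2 * t) := by positivity
  have n1 := mul_nonneg (sub_nonneg.2 h1) hw
  have n2 := mul_nonneg (sub_nonneg.2 h2) hw
  have n4 := mul_nonneg h4 hw
  rw [← ENNReal.ofReal_add n1 n2, ← ENNReal.ofReal_add (add_nonneg n1 n2) n4,
    show (2 : ℝ≥0∞) = ENNReal.ofReal 2 by simp, ← ENNReal.ofReal_mul zero_le_two]
  congr 1
  ring

lemma regEnergy_add_logDefect {ε : ℝ} (hε : 0 < ε) (hε1 : ε ≤ 1) (μ ν : Measure Plane)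
    [IsProbabilityMeasure μ] [IsProbabilityMeasure ν] :
    ∫⁻ p, ENNReal.ofReal (regKernel ε p) ∂(μ.prod ν) + logDefect ε μ ν =
      ∫⁻ x, ENNReal.ofReal (‖x‖ ^ 2 / 2 + (1 - Real.log ε / 2) / 2) ∂μ +
      ∫⁻ x, ENNReal.ofReal (‖x‖ ^ 2 / 2 + (1 - Real.log ε / 2) / 2) ∂ν := by
  have hlog : Real.log ε ≤ 0 := Real.log_nonpos hε.le hε1
  have hm : Measurable fun x : Plane =>
      ENNReal.ofReal (‖x‖ ^ 2 / 2 + (1 - Real.log ε / 2) / 2) := by fun_prop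
  have hn : ∀ x : Plane, 0 ≤ ‖x‖ ^ 2 / 2 + (1 - Real.log ε / 2) / 2 := fun x => by
    have := sq_nonneg ‖x‖
    linarith
  have e1 : ∫⁻ x, ENNReal.ofReal (‖x‖ ^ 2 / 2 + (1 - Real.log ε / 2) / 2) ∂μ =
      ∫⁻ p : Plane × Plane,
        ENNReal.ofReal (‖p.1‖ ^ 2 / 2 + (1 - Real.log ε / 2) / 2) ∂(μ.prod ν) := by
    rw [lintegral_prod _ (by fun_prop)]
    simp
  have e2 : ∫⁻ x, ENNReal.ofReal (‖x‖ ^ 2 / 2 + (1 - Real.log ε / 2) / 2) ∂ν =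
      ∫⁻ p : Plane × Plane,
        ENNReal.ofReal (‖p.2‖ ^ 2 / 2 + (1 - Real.log ε / 2) / 2) ∂(μ.prod ν) := by
    rw [lintegral_prod _ (by fun_prop)]
    simp
  rw [e1, e2, logDefect, ← lintegral_add_left
    (continuous_regKernel hε).measurable.ennreal_ofReal, ← lintegral_add_left (by fun_prop)]
  refine lintegral_congr fun p => ?_
  have := Real.log_le_log hε (le_add_of_nonneg_left (sq_nonneg (dist p.1 p.2)))
  rw [← ENNReal.ofReal_add (regKernel_nonneg hε hε1 p) (by linarith),
    ← ENNReal.ofReal_add (hn _) (hn _)]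
  congr 1
  unfold regKernel
  ring

lemma regEnergy_add {ε : ℝ} (hε : 0 < ε) (hε1 : ε ≤ 1) (μ ν : Measure Plane)
    [IsProbabilityMeasure μ] [IsProbabilityMeasure ν]
    (hμ : wEnergy μ ≠ ⊤) (hν : wEnergy ν ≠ ⊤) :
    2 * ∫⁻ p, ENNReal.ofReal (regKernel ε p) ∂(μ.prod ν) +
      ∫⁻ t in Set.Ioi (0 : ℝ), ENNReal.ofReal
        ((gaussEnergy t μ μ + gaussEnergy t ν ν - 2 * gaussEnergy t μ ν) *
          (Real.exp (-(t * ε)) / (2 * t))) =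
      ∫⁻ p, ENNReal.ofReal (regKernel ε p) ∂(μ.prod μ) +
      ∫⁻ p, ENNReal.ofReal (regKernel ε p) ∂(ν.prod ν) := by
  have hfin : ∀ ρ : Measure Plane, IsProbabilityMeasure ρ → wEnergy ρ ≠ ⊤ →
      logDefect ε ρ ρ ≠ ⊤ := by
    intro ρ _ hρ
    have h2 : ∫⁻ x, ENNReal.ofReal (‖x‖ ^ 2 / 2 + (1 - Real.log ε / 2) / 2) ∂ρ ≠ ⊤ := by
      have hc : 0 ≤ (1 - Real.log ε / 2) / 2 := by
        have := Real.log_nonpos hε.le hε1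
        linarith
      have h3 : ∀ x : Plane, ENNReal.ofReal (‖x‖ ^ 2 / 2 + (1 - Real.log ε / 2) / 2) =
          2 * ENNReal.ofReal (‖x‖ ^ 2 / 4) + ENNReal.ofReal ((1 - Real.log ε / 2) / 2) := by
        intro x
        have h2' : 2 * ENNReal.ofReal (‖x‖ ^ 2 / 4) = ENNReal.ofReal (2 * (‖x‖ ^ 2 / 4)) := by
          rw [ENNReal.ofReal_mul zero_le_two, ENNReal.ofReal_ofNat]
        rw [h2', ← ENNReal.ofReal_add (by positivity) hc]
        congr 1
        ring
      simp_rw [h3]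
      rw [lintegral_add_right _ measurable_const, lintegral_const_mul _ (by fun_prop)]
      refine ENNReal.add_ne_top.2 ⟨ENNReal.mul_ne_top (by simp)
        (ne_top_of_le_ne_top hρ (lintegral_norm_sq_le_wEnergy ρ)), by simp⟩
    have h := regEnergy_add_logDefect hε hε1 ρ ρ
    refine ne_top_of_le_ne_top (ENNReal.add_ne_top.2 ⟨h2, h2⟩) ?_
    rw [← h]
    exact le_add_self
  have hμ' := hfin μ inferInstance hμ
  have hν' := hfin ν inferInstance hν
  have h1 := regEnergy_add_logDefect hε hε1 μ ν
  have h2 := regEnergy_add_logDefect hε hε1 μ μ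
  have h3 := regEnergy_add_logDefect hε hε1 ν ν
  have h4 := logDefect_add hε μ ν
  refine (ENNReal.add_left_inj (ENNReal.add_ne_top.2 ⟨hμ', hν'⟩)).1 ?_
  set E := ∫⁻ p, ENNReal.ofReal (regKernel ε p) ∂(μ.prod ν)
  set Q := ∫⁻ t in Set.Ioi (0 : ℝ), ENNReal.ofReal
        ((gaussEnergy t μ μ + gaussEnergy t ν ν - 2 * gaussEnergy t μ ν) *
          (Real.exp (-(t * ε)) / (2 * t)))
  calc 2 * E + Q + (logDefect ε μ μ + logDefect ε ν ν)
      = 2 * E + (logDefect ε μ μ + logDefect ε ν ν + Q) := by ring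
    _ = 2 * (E + logDefect ε μ ν) := by rw [h4, mul_add]
    _ = _ := by
      rw [h1, add_add_add_comm, h2, h3]
      ring

lemma wEnergy_add {μ ν : Measure Plane} [IsProbabilityMeasure μ] [IsProbabilityMeasure ν]
    (hμ : wEnergy μ ≠ ⊤) (hν : wEnergy ν ≠ ⊤) :
    2 * ∫⁻ p, wKernel p.1 p.2 ∂(μ.prod ν) +
      ∫⁻ t in Set.Ioi (0 : ℝ), ENNReal.ofReal
        ((gaussEnergy t μ μ + gaussEnergy t ν ν - 2 * gaussEnergy t μ ν) *
          (Real.exp (-(t * 1)) / (2 * t))) ≤ wEnergy μ + wEnergy ν := by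
  rw [lintegral_wKernel_eq_iSup, ENNReal.mul_iSup, ENNReal.iSup_add]
  refine iSup_le fun n => ?_
  have hn : (0 : ℝ) < 1 / ((n : ℝ) + 1) := by positivity
  have hn1 : 1 / ((n : ℝ) + 1) ≤ 1 := by
    rw [div_le_one (by positivity)]
    linarith [Nat.cast_nonneg (α := ℝ) n]
  have hle : ∀ ρ : Measure (Plane × Plane),
      ∫⁻ p, ENNReal.ofReal (regKernel (1 / ((n : ℝ) + 1)) p) ∂ρ ≤
        ∫⁻ p, wKernel p.1 p.2 ∂ρ := fun ρ => lintegral_mono fun p => by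
    rw [← iSup_regKernel]
    exact le_iSup (fun n : ℕ => ENNReal.ofReal (regKernel (1 / ((n : ℝ) + 1)) p)) n
  refine le_trans ?_ (add_le_add (hle _) (hle _))
  rw [← regEnergy_add hn hn1 μ ν hμ hν]
  refine add_le_add_right (setLIntegral_mono' measurableSet_Ioi fun t ht => ?_) _
  rw [Set.mem_Ioi] at ht
  refine ENNReal.ofReal_le_ofReal (mul_le_mul_of_nonneg_left ?_ (gaussEnergy_sub_nonneg ht μ ν))
  gcongr

lemma wEnergy_half_add (μ ν : Measure Plane) [IsProbabilityMeasure μ] [IsProbabilityMeasure ν] :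
    4 * wEnergy ((2 : ℝ≥0∞)⁻¹ • (μ + ν)) =
      wEnergy μ + wEnergy ν + 2 * ∫⁻ p, wKernel p.1 p.2 ∂(μ.prod ν) := by
  have hsymm : ∫⁻ p, wKernel p.1 p.2 ∂(ν.prod μ) = ∫⁻ p, wKernel p.1 p.2 ∂(μ.prod ν) := by
    rw [← lintegral_prod_swap]
    exact lintegral_congr fun p => wKernel_comm _ _
  have h4 : (4 : ℝ≥0∞) * (2⁻¹ * 2⁻¹) = 1 := by
    rw [show (4 : ℝ≥0∞) = 2 * 2 by norm_num, mul_mul_mul_comm,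
      ENNReal.mul_inv_cancel two_ne_zero ENNReal.ofNat_ne_top, one_mul]
  rw [wEnergy, Measure.prod_smul_left, Measure.prod_smul_right, lintegral_smul_measure,
    lintegral_smul_measure, smul_eq_mul, smul_eq_mul, ← mul_assoc, ← mul_assoc, mul_assoc 4, h4,
    one_mul, Measure.prod_add, Measure.add_prod, Measure.add_prod]
  simp only [lintegral_add_measure]
  rw [hsymm, wEnergy, wEnergy]
  ring

/-- Strict convexity of the weighted energy, at the midpoint. -/
lemma eq_of_wEnergy_le_half_add {μ ν : Measure Plane} [IsProbabilityMeasure μ]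
    [IsProbabilityMeasure ν] (hμ : wEnergy μ ≠ ⊤) (heq : wEnergy μ = wEnergy ν)
    (h : wEnergy μ ≤ wEnergy ((2 : ℝ≥0∞)⁻¹ • (μ + ν))) : μ = ν := by
  have h1 := wEnergy_add hμ (heq ▸ hμ)
  have h2 : 4 * wEnergy μ ≤ _ := (mul_le_mul_right h 4).trans_eq (wEnergy_half_add μ ν)
  rw [← heq] at h1 h2
  set X := 2 * ∫⁻ p, wKernel p.1 p.2 ∂(μ.prod ν)
  set Q := ∫⁻ t in Set.Ioi (0 : ℝ), ENNReal.ofReal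
        ((gaussEnergy t μ μ + gaussEnergy t ν ν - 2 * gaussEnergy t μ ν) *
          (Real.exp (-(t * 1)) / (2 * t))) with hQdef
  have hfin : wEnergy μ + wEnergy μ ≠ ⊤ := ENNReal.add_ne_top.2 ⟨hμ, hμ⟩
  have h3 : wEnergy μ + wEnergy μ ≤ X := by
    rw [show (4 : ℝ≥0∞) * wEnergy μ = (wEnergy μ + wEnergy μ) + (wEnergy μ + wEnergy μ) by ring]
      at h2
    exact (ENNReal.add_le_add_iff_left hfin).1 h2
  have hQ : Q = 0 := by
    have h5 : (wEnergy μ + wEnergy μ) + Q ≤ (wEnergy μ + wEnergy μ) + 0 := by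
      rw [add_zero]
      exact (add_le_add_left h3 Q).trans h1
    exact le_zero_iff.1 ((ENNReal.add_le_add_iff_left hfin).1 h5)
  have m1 := measurable_gaussEnergy μ μ
  have m2 := measurable_gaussEnergy ν ν
  have m3 := measurable_gaussEnergy μ ν
  rw [hQdef, lintegral_eq_zero_iff (by fun_prop)] at hQ
  have hne : NeZero (volume.restrict (Set.Ioi (0 : ℝ))) := ⟨by simp⟩
  obtain ⟨t, ht0, ht⟩ := (hQ.and (ae_restrict_mem measurableSet_Ioi)).exists
  rw [Set.mem_Ioi] at ht
  refine eq_of_gaussEnergy_sub_nonpos ht μ ν ?_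
  have h6 := ENNReal.ofReal_eq_zero.1 ht0
  exact nonpos_of_mul_nonpos_left h6 (by positivity)

lemma setLIntegral_log_sub_le (t : ℝ) (ht : t ∈ Set.Ioc (0 : ℝ) 1) :
    ∫⁻ s in Set.Ioc (0 : ℝ) 1, ENNReal.ofReal |Real.log (s - t)| ≤
      ∫⁻ u in Set.Ioc (-1 : ℝ) 1, ENNReal.ofReal |Real.log u| := by
  rw [← lintegral_indicator measurableSet_Ioc, ← lintegral_indicator measurableSet_Ioc,
    ← lintegral_sub_right_eq_self
      ((Set.Ioc (-1 : ℝ) 1).indicator fun u => ENNReal.ofReal |Real.log u|) t]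
  refine lintegral_mono fun s => ?_
  refine Set.indicator_apply_le' (fun hs => ?_) fun _ => bot_le
  rw [Set.indicator_of_mem]
  exact ⟨by linarith [hs.1, ht.2], by linarith [hs.2, ht.1]⟩

lemma setLIntegral_abs_log_lt_top :
    ∫⁻ u in Set.Ioc (-1 : ℝ) 1, ENNReal.ofReal |Real.log u| < ⊤ := by
  have h := (intervalIntegral.intervalIntegrable_log' (a := -1) (b := 1)).1
  exact h.abs.lintegral_lt_top

lemma RegularCurve.exists_abs_sub_le_dist {γ : ℝ → Plane} {Γ : Set Plane}
    (hΓ : RegularCurve γ Γ) :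
    ∃ δ : ℝ, 0 < δ ∧ δ ≤ 1 ∧ ∀ s ∈ Set.Ioc 0 δ, ∀ t ∈ Set.Ioc 0 δ,
      |s - t| / 2 ≤ dist (γ s) (γ t) := by
  have h := (hΓ.contDiff.contDiffAt (x := 0)).hasStrictDerivAt one_ne_zero
  have h' := h.isLittleO.def (c := 1 / 2) (by norm_num)
  obtain ⟨ε, hε, hball⟩ := Metric.eventually_nhds_iff.1 h'
  refine ⟨min (ε / 2) 1, by positivity, min_le_right _ _, fun s hs t ht => ?_⟩
  have hst : ∀ r ∈ Set.Ioc 0 (min (ε / 2) 1), dist r (0 : ℝ) < ε := fun r hr => by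
    rw [Real.dist_eq, sub_zero, abs_of_pos hr.1]
    linarith [hr.2, min_le_left (ε / 2) 1]
  have hp := hball (y := (s, t)) (by
    rw [Prod.dist_eq]
    exact max_lt (hst s hs) (hst t ht))
  simp only [ContinuousLinearMap.toSpanSingleton_apply, Real.norm_eq_abs] at hp
  have h1 : ‖(s - t) • deriv γ 0‖ = |s - t| := by
    rw [norm_smul, hΓ.unitSpeed, mul_one, Real.norm_eq_abs]
  have h2 := norm_sub_norm_le ((s - t) • deriv γ 0) (γ s - γ t)
  rw [norm_sub_rev ((s - t) • deriv γ 0), h1] at h2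
  rw [dist_eq_norm]
  linarith

lemma RegularCurve.exists_wEnergy_lt_top {γ : ℝ → Plane} {Γ : Set Plane}
    (hΓ : RegularCurve γ Γ) :
    ∃ μ : Measure Plane, IsProbabilityMeasure μ ∧ μ Γ = 1 ∧ wEnergy μ < ⊤ := by
  obtain ⟨δ, hδ, hδ1, hdist⟩ := hΓ.exists_abs_sub_le_dist
  have hγc : Continuous γ := hΓ.contDiff.continuous
  have hγm : Measurable γ := hγc.measurable
  obtain ⟨B, hB⟩ := (isCompact_Icc (a := (0 : ℝ)) (b := δ)).exists_bound_of_continuousOn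
    hγc.continuousOn
  set lam : Measure ℝ := volume.restrict (Set.Ioc 0 δ) with hlam
  have hc : ENNReal.ofReal δ ≠ 0 := by simpa using hδ
  have hlam_univ : lam Set.univ = ENNReal.ofReal δ := by simp [hlam]
  have : IsFiniteMeasure lam := ⟨by rw [hlam_univ]; simp⟩
  have hmΓ : lam.map γ Γ = ENNReal.ofReal δ := by
    rw [Measure.map_apply hγm hΓ.closed.measurableSet, hΓ.image, Set.preimage_range, hlam_univ]
  have hmuniv : lam.map γ Set.univ = ENNReal.ofReal δ := by
    rw [Measure.map_apply hγm MeasurableSet.univ, Set.preimage_univ, hlam_univ]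
  have hinv : (ENNReal.ofReal δ)⁻¹ * ENNReal.ofReal δ = 1 :=
    ENNReal.inv_mul_cancel hc ENNReal.ofReal_ne_top
  refine ⟨(ENNReal.ofReal δ)⁻¹ • lam.map γ, ⟨?_⟩, ?_, ?_⟩
  · rw [Measure.smul_apply, hmuniv, smul_eq_mul, hinv]
  · rw [Measure.smul_apply, hmΓ, smul_eq_mul, hinv]
  set K := ∫⁻ u in Set.Ioc (-1 : ℝ) 1, ENNReal.ofReal |Real.log u|
  have hkernel : ∀ s ∈ Set.Ioc 0 δ, ∀ t ∈ Set.Ioc 0 δ, s ≠ t → wKernel (γ s) (γ t) ≤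
      ENNReal.ofReal (1 + B ^ 2 + Real.log 2) + ENNReal.ofReal |Real.log (s - t)| := by
    intro s hs t ht hst
    have hpos : 0 < |s - t| := abs_pos.2 (sub_ne_zero.2 hst)
    rw [wKernel_of_ne (hΓ.injective.ne hst), Real.log_pow]
    refine (ENNReal.ofReal_le_ofReal ?_).trans ENNReal.ofReal_add_le
    have h1 := Real.log_le_log (by positivity) (hdist s hs t ht)
    rw [Real.log_div hpos.ne' two_ne_zero, Real.log_abs] at h1
    have h2 := neg_abs_le (Real.log (s - t))
    have h3 := pow_le_pow_left₀ (norm_nonneg _) (hB s (Set.Ioc_subset_Icc_self hs)) 2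
    have h4 := pow_le_pow_left₀ (norm_nonneg _) (hB t (Set.Ioc_subset_Icc_self ht)) 2
    push_cast
    linarith
  have hinner : ∀ t ∈ Set.Ioc 0 δ, ∫⁻ s, wKernel (γ s) (γ t) ∂lam ≤
      ENNReal.ofReal (1 + B ^ 2 + Real.log 2) * ENNReal.ofReal δ + K := by
    intro t ht
    calc _ ≤ ∫⁻ s, (ENNReal.ofReal (1 + B ^ 2 + Real.log 2) +
          ENNReal.ofReal |Real.log (s - t)|) ∂lam := by
          refine lintegral_mono_ae ?_
          have hne : ∀ᵐ s ∂lam, s ≠ t := ae_restrict_of_ae (Measure.ae_ne volume t)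
          filter_upwards [hne, ae_restrict_mem measurableSet_Ioc] with s hst hs
          exact hkernel s hs t ht hst
      _ = ENNReal.ofReal (1 + B ^ 2 + Real.log 2) * ENNReal.ofReal δ +
          ∫⁻ s, ENNReal.ofReal |Real.log (s - t)| ∂lam := by
          rw [lintegral_add_left measurable_const, lintegral_const, hlam_univ]
      _ ≤ _ := by
          gcongr
          exact (lintegral_mono_set (Set.Ioc_subset_Ioc_right hδ1)).trans
            (setLIntegral_log_sub_le t ⟨ht.1, ht.2.trans hδ1⟩)
  have hmap : ∫⁻ p, wKernel p.1 p.2 ∂((lam.map γ).prod (lam.map γ)) < ⊤ := by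
    rw [Measure.map_prod_map _ _ hγm hγm, lintegral_map measurable_wKernel
      (hγm.prodMap hγm), lintegral_prod_symm]
    swap
    · exact (measurable_wKernel.comp (hγm.prodMap hγm)).aemeasurable
    calc _ ≤ ∫⁻ _, (ENNReal.ofReal (1 + B ^ 2 + Real.log 2) * ENNReal.ofReal δ + K) ∂lam := by
          refine lintegral_mono_ae ?_
          filter_upwards [ae_restrict_mem measurableSet_Ioc] with t ht
          exact hinner t ht
      _ < ⊤ := by
          rw [lintegral_const]
          exact ENNReal.mul_lt_top (ENNReal.add_lt_top.2 ⟨ENNReal.mul_lt_top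
            ENNReal.ofReal_lt_top ENNReal.ofReal_lt_top, setLIntegral_abs_log_lt_top⟩)
            (measure_lt_top _ _)
  have hcinv : (ENNReal.ofReal δ)⁻¹ < ⊤ := ENNReal.inv_lt_top.2 (pos_iff_ne_zero.2 hc)
  rw [wEnergy, Measure.prod_smul_left, Measure.prod_smul_right, lintegral_smul_measure,
    lintegral_smul_measure, smul_eq_mul, smul_eq_mul]
  exact ENNReal.mul_lt_top hcinv (ENNReal.mul_lt_top hcinv hmap)

lemma isCompact_closure_setOf_wEnergy_le {C : ℝ≥0∞} (hC : C ≠ ⊤) :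
    IsCompact (closure {μ : ProbabilityMeasure Plane | wEnergy (μ : Measure Plane) ≤ C}) := by
  refine isCompact_closure_of_isTightMeasureSet
    (isTightMeasureSet_of_tendsto_measure_norm_gt ?_)
  have hlim : Filter.Tendsto (fun r : ℝ => C / ENNReal.ofReal (r ^ 2 / 4)) Filter.atTop
      (nhds 0) := by
    rw [← ENNReal.div_top (a := C)]
    refine ENNReal.Tendsto.const_div (ENNReal.tendsto_ofReal_atTop.comp ?_) (Or.inr hC)
    exact (Filter.tendsto_pow_atTop two_ne_zero).atTop_div_const (by norm_num)
  refine tendsto_of_tendsto_of_tendsto_of_le_of_le' tendsto_const_nhds hlim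
    (Filter.Eventually.of_forall fun _ => bot_le) ?_
  filter_upwards [Filter.eventually_gt_atTop 0] with r hr
  refine iSup₂_le fun ρ hρ => ?_
  obtain ⟨μ, hμ, rfl⟩ := hρ
  have hsub : {x : Plane | r < ‖x‖} ⊆
      {x | ENNReal.ofReal (r ^ 2 / 4) ≤ ENNReal.ofReal (‖x‖ ^ 2 / 4)} := fun x hx => by
    have hx' : r < ‖x‖ := hx
    refine ENNReal.ofReal_le_ofReal ?_
    gcongr
  have hpos : ENNReal.ofReal (r ^ 2 / 4) ≠ 0 := by
    rw [Ne, ENNReal.ofReal_eq_zero, not_le]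
    positivity
  refine (measure_mono hsub).trans ?_
  refine (meas_ge_le_lintegral_div (by fun_prop) hpos ENNReal.ofReal_ne_top).trans ?_
  exact ENNReal.div_le_div_right ((lintegral_norm_sq_le_wEnergy _).trans hμ) _

lemma exists_wEnergy_eq_iInf {Γ : Set Plane} (hΓ : IsClosed Γ) {a : ℝ}
    (hfin : (⨅ μ ∈ Ma Γ a, wEnergy μ) < ⊤) :
    ∃ μ ∈ Ma Γ a, wEnergy μ = ⨅ μ ∈ Ma Γ a, wEnergy μ := by
  rw [← sInf_image] at hfin ⊢
  have hne : (wEnergy '' Ma Γ a).Nonempty := by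
    by_contra h
    rw [Set.not_nonempty_iff_eq_empty.1 h] at hfin
    simp at hfin
  obtain ⟨u, -, hu, huS⟩ := exists_seq_tendsto_sInf hne (OrderBot.bddBelow _)
  obtain ⟨C, hC, hCtop⟩ := exists_between hfin
  obtain ⟨N, hN⟩ := Filter.eventually_atTop.1 (hu.eventually_lt_const hC)
  choose μ hμ hμu using huS
  have := fun n => (hμ n).1
  set ρ : ℕ → ProbabilityMeasure Plane := fun n => ⟨μ (n + N), this _⟩
  have hρS : ∀ n, ρ n ∈ closure {μ : ProbabilityMeasure Plane |
      wEnergy (μ : Measure Plane) ≤ C} := fun n => subset_closure <| by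
    change wEnergy (μ (n + N)) ≤ C
    rw [hμu]
    exact (hN _ (Nat.le_add_left _ _)).le
  obtain ⟨ν, -, φ, hφ, hlim⟩ := (isCompact_closure_setOf_wEnergy_le hCtop.ne).tendsto_subseq hρS
  have hνM : (ν : Measure Plane) ∈ Ma Γ a := by
    refine ⟨inferInstance, le_trans ?_
      (ProbabilityMeasure.limsup_measure_closed_le_of_tendsto hlim hΓ)⟩
    refine le_trans (Filter.le_liminf_of_le (by isBoundedDefault)
      (Filter.Eventually.of_forall fun n => (hμ (φ n + N)).2)) Filter.liminf_le_limsup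
  refine ⟨ν, hνM, le_antisymm ?_ (sInf_le ⟨ν, hνM, rfl⟩)⟩
  refine (wEnergy_le_liminf hlim).trans_eq (Filter.Tendsto.liminf_eq ?_)
  have h := (hu.comp (Filter.tendsto_add_atTop_nat N)).comp hφ.tendsto_atTop
  refine h.congr fun n => ?_
  exact (hμu (φ n + N)).symm

lemma half_add_mem_Ma {Γ : Set Plane} {a : ℝ} {μ ν : Measure Plane} (hμ : μ ∈ Ma Γ a)
    (hν : ν ∈ Ma Γ a) : (2 : ℝ≥0∞)⁻¹ • (μ + ν) ∈ Ma Γ a := by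
  have hμ1 := hμ.1
  have hν1 := hν.1
  have h2 : ∀ x : ℝ≥0∞, 2⁻¹ * (x + x) = x := fun x => by
    rw [← two_mul, ← mul_assoc, ENNReal.inv_mul_cancel two_ne_zero ENNReal.ofNat_ne_top, one_mul]
  refine ⟨⟨?_⟩, ?_⟩
  · rw [Measure.smul_apply, Measure.add_apply, measure_univ, measure_univ, smul_eq_mul, h2]
  · rw [Measure.smul_apply, Measure.add_apply, smul_eq_mul, ← h2 (ENNReal.ofReal a)]
    gcongr
    exacts [hμ.2, hν.2]

theorem statement0 (γ : ℝ → Plane) (Γ : Set Plane) (hΓ : RegularCurve γ Γ)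
    (a : ℝ) (ha : a ∈ Set.Ioo (0:ℝ) 1) :
    (⨅ μ ∈ Ma Γ a, wEnergy μ) < ⊤ ∧
    ∃! μa : Measure Plane, μa ∈ Ma Γ a ∧ wEnergy μa = ⨅ μ ∈ Ma Γ a, wEnergy μ := by
  have hfin : (⨅ μ ∈ Ma Γ a, wEnergy μ) < ⊤ := by
    obtain ⟨μ, hμ, hμΓ, hE⟩ := hΓ.exists_wEnergy_lt_top
    refine (iInf₂_le μ ⟨hμ, ?_⟩).trans_lt hE
    rw [hμΓ]
    exact ENNReal.ofReal_le_one.2 ha.2.le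
  refine ⟨hfin, ?_⟩
  obtain ⟨μ, hμ, hE⟩ := exists_wEnergy_eq_iInf hΓ.closed hfin
  refine ⟨μ, ⟨hμ, hE⟩, ?_⟩
  rintro ν ⟨hν, hEν⟩
  have := hμ.1
  have := hν.1
  refine eq_of_wEnergy_le_half_add (hEν ▸ hfin.ne) (hEν.trans hE.symm) ?_
  rw [hEν]
  exact iInf₂_le _ (half_add_mem_Ma hν hμ)
end

section
/- The double integral ∫₀^L ∫₀^L log(1/|γ(t)−γ(s)|) dt ds is finite, i.e. the function (t,s) ↦ log(1/|γ(t)−γ(s)|) is integrable on [0,L]×[0,L] (note it is bounded below by log(1/L), since |γ(t)−γ(s)| ≤ |t−s| ≤ L). -/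
open MeasureTheory Real
open scoped ENNReal

/-- A continuously differentiable injective arc with unit speed satisfies a chord-arc bound. -/
theorem exists_chord_arc_bound {E : Type*} [NormedAddCommGroup E] [NormedSpace ℝ E]
    {L : ℝ} {γ γ' : ℝ → E} (hinj : Set.InjOn γ (Set.Icc 0 L))
    (hderiv : ∀ t ∈ Set.Icc (0:ℝ) L, HasDerivWithinAt γ (γ' t) (Set.Icc 0 L) t)
    (hcont : ContinuousOn γ' (Set.Icc 0 L))
    (hunit : ∀ t ∈ Set.Icc (0:ℝ) L, ‖γ' t‖ = 1) :
    ∃ c > 0, ∀ t ∈ Set.Icc (0:ℝ) L, ∀ s ∈ Set.Icc (0:ℝ) L,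
      c * |t - s| ≤ dist (γ t) (γ s) := by
  have hγ : ContinuousOn γ (Set.Icc 0 L) := fun t ht => (hderiv t ht).continuousWithinAt
  have huc := isCompact_Icc.uniformContinuousOn_of_continuous hcont
  obtain ⟨δ, hδ, hnear⟩ := Metric.uniformContinuousOn_iff.1 huc (1 / 2) (by norm_num)
  have local_bound : ∀ t ∈ Set.Icc (0:ℝ) L, ∀ s ∈ Set.Icc (0:ℝ) L, |t - s| < δ →
      1 / 2 * |t - s| ≤ dist (γ t) (γ s) := by
    intro t ht s hs hts
    have hsub : Set.uIcc s t ⊆ Set.Icc 0 L := Set.uIcc_subset_Icc hs ht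
    have key := (convex_uIcc s t).norm_image_sub_le_of_norm_hasDerivWithin_le
      (f := fun u => γ u - u • γ' s) (f' := fun u => γ' u - (1 : ℝ) • γ' s) (C := 1 / 2)
      (x := s) (y := t)
      (fun u hu => ((hderiv u (hsub hu)).mono hsub).sub
        ((hasDerivWithinAt_id u _).smul_const (γ' s)))
      (fun u hu => by
        have hus : dist u s < δ := by
          rw [Real.dist_eq]
          exact (Set.abs_sub_left_of_mem_uIcc hu).trans_lt hts
        have := hnear u (hsub hu) s hs hus
        rw [dist_eq_norm] at this
        simpa using this.le)
      Set.left_mem_uIcc Set.right_mem_uIcc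
    have hsplit : (t - s) • γ' s =
        (γ t - γ s) - ((γ t - t • γ' s) - (γ s - s • γ' s)) := by module
    have hnorm : |t - s| = ‖(t - s) • γ' s‖ := by
      rw [norm_smul, hunit s hs, mul_one, Real.norm_eq_abs]
    have htri := norm_sub_le (γ t - γ s) ((γ t - t • γ' s) - (γ s - s • γ' s))
    rw [← hsplit, ← hnorm] at htri
    rw [Real.norm_eq_abs] at key
    rw [dist_eq_norm]
    linarith
  set K : Set (ℝ × ℝ) := (Set.Icc 0 L ×ˢ Set.Icc 0 L) ∩ {p | δ ≤ |p.1 - p.2|} with hK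
  have hKc : IsCompact K := (isCompact_Icc.prod isCompact_Icc).inter_right
    (isClosed_le continuous_const (by fun_prop))
  have hdist : ContinuousOn (fun p : ℝ × ℝ => dist (γ p.1) (γ p.2)) K :=
    continuous_dist.comp_continuousOn
      ((hγ.comp continuousOn_fst fun p hp => hp.1.1).prodMk
        (hγ.comp continuousOn_snd fun p hp => hp.1.2))
  obtain ⟨m, hm, hfar⟩ := hKc.exists_forall_le' hdist (a := 0) (fun p hp => by
    refine dist_pos.2 fun h => ?_
    have heq := hinj hp.1.1 hp.1.2 h
    have hge : δ ≤ |p.1 - p.2| := hp.2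
    rw [heq, sub_self, abs_zero] at hge
    exact hδ.not_ge hge)
  refine ⟨min (1 / 2) (m / (|L| + 1)), by positivity, fun t ht s hs => ?_⟩
  rcases lt_or_ge |t - s| δ with h | h
  · exact (mul_le_mul_of_nonneg_right (min_le_left _ _) (abs_nonneg _)).trans
      (local_bound t ht s hs h)
  · have hle : |t - s| ≤ |L| + 1 := by
      have := le_abs_self L
      rw [abs_le]
      constructor <;> linarith [ht.1, ht.2, hs.1, hs.2]
    calc min (1 / 2) (m / (|L| + 1)) * |t - s|
        ≤ m / (|L| + 1) * (|L| + 1) :=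
          mul_le_mul (min_le_right _ _) hle (abs_nonneg _) (by positivity)
      _ = m := by field_simp
      _ ≤ dist (γ t) (γ s) := hfar (t, s) ⟨⟨ht, hs⟩, h⟩

theorem integrableOn_log_sub (L : ℝ) :
    IntegrableOn (fun p : ℝ × ℝ => Real.log (p.1 - p.2))
      (Set.Icc 0 L ×ˢ Set.Icc 0 L) volume := by
  have hlog : IntegrableOn Real.log (Set.Icc (-L) L) volume := by
    rcases le_or_gt (-L) L with h | h
    · exact (intervalIntegrable_iff_integrableOn_Icc_of_le h).1
        intervalIntegral.intervalIntegrable_log'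
    · simp [Set.Icc_eq_empty_of_lt h]
  have hone : IntegrableOn (fun _ : ℝ => (1 : ℝ)) (Set.Icc 0 L) volume :=
    integrableOn_const (by simp)
  have hconv := (hone.integrable_indicator measurableSet_Icc).convolution_integrand
    (ContinuousLinearMap.mul ℝ ℝ) (hlog.integrable_indicator measurableSet_Icc)
  refine (hconv.integrableOn (s := Set.Icc 0 L ×ˢ Set.Icc 0 L)).congr_fun ?_
    (measurableSet_Icc.prod measurableSet_Icc)
  rintro ⟨t, s⟩ ⟨ht, hs⟩
  have hts : t - s ∈ Set.Icc (-L) L := by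
    constructor <;> linarith [ht.1, ht.2, hs.1, hs.2]
  have hs' : s ∈ Set.Icc 0 L := hs
  simp only [Set.indicator_of_mem hs', Set.indicator_of_mem hts, ContinuousLinearMap.mul_apply',
    one_mul]

/-- for an injective arc-length parametrized `C^{1,α}` arc
`γ : [0,L] → ℝ²`, the function `(t,s) ↦ log (1/|γ(t) - γ(s)|)` is integrable on
`[0,L] × [0,L]`. -/
theorem statement1 (L : ℝ) (hL : 0 < L) (γ : ℝ → Plane) (γ' : ℝ → Plane)
    (hinj : Set.InjOn γ (Set.Icc 0 L))
    (hderiv : ∀ t ∈ Set.Icc (0:ℝ) L, HasDerivWithinAt γ (γ' t) (Set.Icc 0 L) t)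
    (hcont : ContinuousOn γ' (Set.Icc 0 L))
    (hunit : ∀ t ∈ Set.Icc (0:ℝ) L, ‖γ' t‖ = 1)
    (α : ℝ) (hα : α ∈ Set.Ioc (0:ℝ) 1)
    (M : ℝ) (hM : 0 ≤ M)
    (hhold : ∀ s ∈ Set.Icc (0:ℝ) L, ∀ t ∈ Set.Icc (0:ℝ) L,
      ‖γ' t - γ' s‖ ≤ M * |t - s| ^ α) :
    IntegrableOn (fun p : ℝ × ℝ => Real.log (1 / dist (γ p.1) (γ p.2)))
      (Set.Icc 0 L ×ˢ Set.Icc 0 L) volume := by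
  obtain ⟨c, hc, hlow⟩ := exists_chord_arc_bound hinj hderiv hcont hunit
  have hup : ∀ t ∈ Set.Icc (0:ℝ) L, ∀ s ∈ Set.Icc (0:ℝ) L, dist (γ t) (γ s) ≤ |t - s| := by
    intro t ht s hs
    simpa [dist_eq_norm] using (convex_Icc 0 L).norm_image_sub_le_of_norm_hasDerivWithin_le
      hderiv (fun u hu => (hunit u hu).le) hs ht
  have hγ : ContinuousOn γ (Set.Icc 0 L) := fun t ht => (hderiv t ht).continuousWithinAt
  have hsq : MeasurableSet (Set.Icc 0 L ×ˢ Set.Icc 0 L : Set (ℝ × ℝ)) :=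
    measurableSet_Icc.prod measurableSet_Icc
  have hdist : ContinuousOn (fun p : ℝ × ℝ => dist (γ p.1) (γ p.2))
      (Set.Icc 0 L ×ˢ Set.Icc 0 L) :=
    continuous_dist.comp_continuousOn
      ((hγ.comp continuousOn_fst fun p hp => hp.1).prodMk
        (hγ.comp continuousOn_snd fun p hp => hp.2))
  have hconst : IntegrableOn (fun _ : ℝ × ℝ => |Real.log c|)
      (Set.Icc 0 L ×ˢ Set.Icc 0 L) volume :=
    integrableOn_const (isCompact_Icc.prod isCompact_Icc).measure_lt_top.ne
  refine ((integrableOn_log_sub L).norm.add hconst).mono'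
    (((hdist.aemeasurable hsq).const_div 1).log.aestronglyMeasurable) ?_
  refine (ae_restrict_iff' hsq).2 (.of_forall ?_)
  rintro ⟨t, s⟩ ⟨ht, hs⟩
  have ht' : t ∈ Set.Icc 0 L := ht
  have hs' : s ∈ Set.Icc 0 L := hs
  simp only [Pi.add_apply, Real.norm_eq_abs, one_div, Real.log_inv, abs_neg]
  rcases eq_or_ne t s with rfl | hne
  · simp
  have hpos : 0 < |t - s| := abs_pos.2 (sub_ne_zero.2 hne)
  have hlog_low := Real.log_le_log (mul_pos hc hpos) (hlow t ht' s hs')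
  have hlog_up := Real.log_le_log ((mul_pos hc hpos).trans_le (hlow t ht' s hs'))
    (hup t ht' s hs')
  rw [Real.log_mul hc.ne' hpos.ne', Real.log_abs] at hlog_low
  rw [Real.log_abs] at hlog_up
  rw [abs_le]
  constructor
  · linarith [neg_abs_le (Real.log c), neg_abs_le (Real.log (t - s))]
  · linarith [abs_nonneg (Real.log c), le_abs_self (Real.log (t - s))]
end

section
/- The function K₁(x) = log(1/|x|)·1_{0<|x|≤1} is integrable on ℝ², and its Fourier transform F K₁(ξ) = ∫_{ℝ²} K₁(x) e^{−2πi⟨x,ξ⟩} dx satisfies F K₁(ξ) = (1 − J₀(2π|ξ|)) / (2π|ξ|²) for every ξ ≠ 0, and F K₁(0) = π/2. -/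
open MeasureTheory Real
open scoped ENNReal FourierTransform

/-- The truncated logarithmic kernel on `ℝ²`: `K₁(x) = log(1/|x|)` for
`0 < |x| ≤ 1` and `K₁(x) = 0` for `|x| > 1`. -/
noncomputable def K1 (x : Plane) : ℝ := if ‖x‖ ≤ 1 then Real.log (1 / ‖x‖) else 0

/-- The Bessel function of order zero,
`J₀(t) = (1/2π) ∫₀^{2π} cos (t sin θ) dθ`. -/
noncomputable def J0 (t : ℝ) : ℝ :=
  (1 / (2 * π)) * ∫ θ in (0:ℝ)..(2 * π), Real.cos (t * Real.sin θ)

open Set in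
/-- If `F` has continuous `t`-derivative `F'`, bounded by `1`, then the integral of `F t` over a
bounded interval can be differentiated under the integral sign. -/
lemma hasDerivAt_intervalIntegral_of_norm_deriv_le_one {F F' : ℝ → ℝ → ℝ} (a b : ℝ)
    (hF : ∀ t, Continuous (F t)) (hF' : ∀ t, Continuous (F' t))
    (hbound : ∀ t θ, ‖F' t θ‖ ≤ 1) (hderiv : ∀ t θ, HasDerivAt (fun s => F s θ) (F' t θ) t)
    (t : ℝ) :
    HasDerivAt (fun s => ∫ θ in a..b, F s θ) (∫ θ in a..b, F' t θ) t :=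
  (intervalIntegral.hasDerivAt_integral_of_dominated_loc_of_deriv_le (bound := fun _ => 1)
    (s := univ) Filter.univ_mem (.of_forall fun s => (hF s).aestronglyMeasurable)
    ((hF t).intervalIntegrable _ _) (hF' t).aestronglyMeasurable
    (.of_forall fun θ _ s _ => hbound s θ) intervalIntegrable_const
    (.of_forall fun θ _ s _ => hderiv s θ)).2

/-- The Bessel function of order one, `J₁(t) = (1/2π) ∫₀^{2π} sin θ sin (t sin θ) dθ`. -/
noncomputable def J1 (t : ℝ) : ℝ :=
  (1 / (2 * π)) * ∫ θ in (0:ℝ)..(2 * π), sin θ * sin (t * sin θ)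

lemma hasDerivAt_J0 (t : ℝ) : HasDerivAt J0 (-J1 t) t := by
  have h := hasDerivAt_intervalIntegral_of_norm_deriv_le_one
    (F := fun t θ => cos (t * sin θ)) (F' := fun t θ => -(sin θ * sin (t * sin θ))) 0 (2 * π)
    (fun t => by fun_prop) (fun t => by fun_prop)
    (fun t θ => by
      rw [norm_neg, norm_mul]
      exact mul_le_one₀ (abs_sin_le_one _) (norm_nonneg _) (abs_sin_le_one _))
    (fun t θ => (hasDerivAt_mul_const (sin θ)).cos.congr_deriv (by ring)) t
  exact (h.const_mul (1 / (2 * π))).congr_deriv (by simp [J1])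

lemma continuous_J0 : Continuous J0 :=
  continuous_iff_continuousAt.2 fun t => (hasDerivAt_J0 t).continuousAt

/-- Integration by parts in the defining integral of `J1`. -/
lemma integral_sin_mul_sin_mul_sin (t : ℝ) :
    ∫ θ in (0:ℝ)..(2 * π), sin θ * sin (t * sin θ)
      = ∫ θ in (0:ℝ)..(2 * π), t * cos θ ^ 2 * cos (t * sin θ) := by
  have hderiv (θ : ℝ) : HasDerivAt (fun θ => cos θ * sin (t * sin θ))
      (t * cos θ ^ 2 * cos (t * sin θ) - sin θ * sin (t * sin θ)) θ := 
    ((hasDerivAt_cos θ).mul ((hasDerivAt_sin θ).const_mul t).sin).congr_deriv (by ring)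
  have h := intervalIntegral.integral_eq_sub_of_hasDerivAt (a := 0) (b := 2 * π)
    (fun θ _ => hderiv θ) (Continuous.intervalIntegrable (by fun_prop) _ _)
  rw [intervalIntegral.integral_sub (Continuous.intervalIntegrable (by fun_prop) _ _)
    (Continuous.intervalIntegrable (by fun_prop) _ _)] at h
  simp only [sin_two_pi, sin_zero, mul_zero, sub_self] at h
  linarith

lemma hasDerivAt_J1 (t : ℝ) : HasDerivAt J1
    ((1 / (2 * π)) * ∫ θ in (0:ℝ)..(2 * π), sin θ ^ 2 * cos (t * sin θ)) t :=
  HasDerivAt.const_mul (1 / (2 * π)) <| hasDerivAt_intervalIntegral_of_norm_deriv_le_one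
    (F := fun t θ => sin θ * sin (t * sin θ)) (F' := fun t θ => sin θ ^ 2 * cos (t * sin θ))
    0 (2 * π) (fun t => by fun_prop) (fun t => by fun_prop)
    (fun t θ => by
      rw [norm_mul, norm_pow]
      exact mul_le_one₀ (pow_le_one₀ (norm_nonneg _) (abs_sin_le_one _)) (norm_nonneg _)
        (abs_cos_le_one _))
    (fun t θ => ((hasDerivAt_mul_const (sin θ)).sin.const_mul (sin θ)).congr_deriv (by ring)) t

lemma continuous_J1 : Continuous J1 :=
  continuous_iff_continuousAt.2 fun t => (hasDerivAt_J1 t).continuousAt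

lemma hasDerivAt_mul_J1 (t : ℝ) : HasDerivAt (fun s => s * J1 s) (t * J0 t) t := by
  refine ((hasDerivAt_id t).mul (hasDerivAt_J1 t)).congr_deriv ?_
  simp only [J0, J1, id, one_mul]
  rw [integral_sin_mul_sin_mul_sin, mul_left_comm t, mul_left_comm t, ← mul_add,
    ← intervalIntegral.integral_const_mul, ← intervalIntegral.integral_const_mul,
    ← intervalIntegral.integral_add (Continuous.intervalIntegrable (by fun_prop) _ _)
    (Continuous.intervalIntegrable (by fun_prop) _ _)]
  congr 2 with θ
  rw [cos_sq']
  ring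

lemma J0_zero : J0 0 = 1 := by
  simp [J0]
  field_simp

/-- A function of `sin` is integrated over a period in the same way as a shifted `cos`. -/
lemma integral_comp_cos_sub {E : Type*} [NormedAddCommGroup E] [NormedSpace ℝ E]
    (f : ℝ → E) (φ : ℝ) :
    ∫ θ in (-π)..π, f (cos (θ - φ)) = ∫ θ in (0:ℝ)..(2 * π), f (sin θ) := by
  have hper : Function.Periodic (fun θ => f (sin θ)) (2 * π) := fun θ => by
    simp [sin_add_two_pi]
  have h := hper.intervalIntegral_add_eq (-π + (π / 2 - φ)) 0
  rw [zero_add] at h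
  rw [← h, show -π + (π / 2 - φ) + 2 * π = π + (π / 2 - φ) by ring,
    ← intervalIntegral.integral_comp_add_right (fun θ => f (sin θ))]
  congr 1 with θ
  rw [show θ + (π / 2 - φ) = (θ - φ) + π / 2 by ring, sin_add_pi_div_two]

lemma integral_sin_mul_sin_eq_zero (t : ℝ) : ∫ θ in (0:ℝ)..(2 * π), sin (t * sin θ) = 0 := by
  have h := intervalIntegral.integral_comp_sub_left (a := 0) (b := 2 * π)
    (fun θ => sin (t * sin θ)) (2 * π)
  simp only [sin_two_pi_sub, mul_neg, sin_neg, intervalIntegral.integral_neg, sub_self,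
    sub_zero] at h
  linarith

/-- The integral of a plane wave over a circle. -/
lemma integral_exp_mul_cos_sub (t φ : ℝ) :
    ∫ θ in (-π)..π, Complex.exp (↑(-(t * cos (θ - φ))) * Complex.I) = ((2 * π * J0 t : ℝ) : ℂ) := by
  have hexp (θ : ℝ) : Complex.exp (↑(-(t * sin θ)) * Complex.I)
      = ((cos (t * sin θ) : ℝ) : ℂ) - ((sin (t * sin θ) : ℝ) : ℂ) * Complex.I := by
    rw [Complex.exp_mul_I, ← Complex.ofReal_cos, ← Complex.ofReal_sin, cos_neg, sin_neg]
    push_cast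
    ring
  rw [integral_comp_cos_sub (fun u => Complex.exp (↑(-(t * u)) * Complex.I))]
  simp_rw [hexp]
  rw [intervalIntegral.integral_sub (Continuous.intervalIntegrable (by fun_prop) _ _)
    (Continuous.intervalIntegrable (by fun_prop) _ _), intervalIntegral.integral_mul_const,
    intervalIntegral.integral_ofReal, intervalIntegral.integral_ofReal,
    integral_sin_mul_sin_eq_zero]
  simp only [J0, Complex.ofReal_zero, zero_mul, sub_zero]
  congr 1
  field_simp

lemma integrable_comp_norm_plane_iff (ρ : ℝ → ℝ) :
    Integrable (fun x : Plane => ρ ‖x‖) ↔ IntegrableOn (fun r => r * ρ r) (Set.Ioi 0) := by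
  rw [integrable_fun_norm_addHaar]
  simp

/-- The Fourier transform of a radial function on the plane is its Hankel transform. -/
lemma fourier_comp_norm_plane {ρ : ℝ → ℝ}
    (hρ : IntegrableOn (fun r => r * ρ r) (Set.Ioi 0)) (ξ : Plane) :
    𝓕 (fun x : Plane => (ρ ‖x‖ : ℂ)) ξ
      = ((2 * π * ∫ r in Set.Ioi 0, r * ρ r * J0 (2 * π * ‖ξ‖ * r) : ℝ) : ℂ) := by
  let e : ℂ ≃ₗᵢ[ℝ] Plane := Complex.orthonormalBasisOneI.repr
  obtain ⟨w, rfl⟩ := e.surjective ξ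
  have hinner (r θ : ℝ) : inner ℝ (r * (cos θ + sin θ * Complex.I) : ℂ) w
      = ‖w‖ * r * cos (θ - w.arg) := by
    rw [Complex.inner, cos_sub]
    simp only [Complex.mul_re, Complex.conj_re, Complex.conj_im, Complex.mul_im, Complex.add_re,
      Complex.add_im, Complex.ofReal_re, Complex.ofReal_im, Complex.I_re, Complex.I_im]
    rw [← Complex.norm_mul_cos_arg w, ← Complex.norm_mul_sin_arg w]
    ring
  have hint : IntegrableOn (fun p : ℝ × ℝ => ((p.1 * ρ p.1 : ℝ) : ℂ) *
      Complex.exp (↑(-(2 * π * ‖w‖ * p.1 * cos (p.2 - w.arg))) * Complex.I))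
      (Set.Ioi (0 : ℝ) ×ˢ Set.Ioo (-π) π) := by
    have h1 : IntegrableOn (fun p : ℝ × ℝ => ((p.1 * ρ p.1 : ℝ) : ℂ) * 1)
        (Set.Ioi (0 : ℝ) ×ˢ Set.Ioo (-π) π) := by
      rw [IntegrableOn, Measure.volume_eq_prod, ← Measure.prod_restrict]
      exact hρ.ofReal.mul_prod (g := fun _ => (1 : ℂ)) (integrable_const _)
    simp only [mul_one] at h1
    refine Integrable.mul_bdd (c := 1) h1 (Continuous.aestronglyMeasurable (by fun_prop)) ?_
    exact .of_forall fun p => (Complex.norm_exp_ofReal_mul_I _).le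
  calc 𝓕 (fun x : Plane => (ρ ‖x‖ : ℂ)) (e w)
    _ = ∫ z : ℂ, Complex.exp (↑(-2 * π * inner ℝ z w) * Complex.I) * ρ ‖z‖ := by
      rw [fourier_eq', ← e.measurePreserving.integral_comp e.toMeasurableEquiv.measurableEmbedding]
      simp [e.inner_map_map]
    _ = ∫ p in Set.Ioi (0 : ℝ) ×ˢ Set.Ioo (-π) π, ((p.1 * ρ p.1 : ℝ) : ℂ) *
          Complex.exp (↑(-(2 * π * ‖w‖ * p.1 * cos (p.2 - w.arg))) * Complex.I) := by
      rw [← Complex.integral_comp_polarCoord_symm, polarCoord_target]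
      refine setIntegral_congr_fun (measurableSet_Ioi.prod measurableSet_Ioo) fun p hp => ?_
      have hp : 0 < p.1 := hp.1
      rw [Complex.norm_polarCoord_symm, abs_of_pos hp, Complex.polarCoord_symm_apply, hinner,
        Complex.real_smul, mul_comm (Complex.exp _), ← mul_assoc, ← Complex.ofReal_mul]
      congr 4
      ring
    _ = ∫ r in Set.Ioi (0 : ℝ), ((2 * π * (r * ρ r * J0 (2 * π * ‖w‖ * r)) : ℝ) : ℂ) := by
      rw [Measure.volume_eq_prod, setIntegral_prod _ hint]
      refine setIntegral_congr_fun measurableSet_Ioi fun r _ => ?_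
      simp only
      rw [integral_const_mul, ← integral_Ioc_eq_integral_Ioo,
        ← intervalIntegral.integral_of_le (by linarith [pi_pos]), integral_exp_mul_cos_sub,
        ← Complex.ofReal_mul]
      congr 1
      ring
    _ = _ := by
      rw [integral_complex_ofReal, integral_const_mul, e.norm_map]

/-- On `(0, ∞)`, the truncated logarithm with the area factor `r` is `-r log r` cut off at `1`. -/
lemma mul_truncated_log_eq_indicator :
    Set.EqOn (fun r : ℝ => r * if r ≤ 1 then log (1 / r) else 0)
      ((Set.Ioc 0 1).indicator fun r => -(r * log r)) (Set.Ioi 0) := by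
  intro r hr
  have hr : 0 < r := hr
  by_cases h : r ≤ 1 <;> simp [h, hr]

lemma integrableOn_mul_truncated_log :
    IntegrableOn (fun r : ℝ => r * if r ≤ 1 then log (1 / r) else 0) (Set.Ioi 0) := by
  rw [integrableOn_congr_fun mul_truncated_log_eq_indicator measurableSet_Ioi]
  refine IntegrableOn.integrable_indicator ?_ measurableSet_Ioc |>.integrableOn
  exact (continuous_mul_log.neg.integrableOn_Icc (a := 0) (b := 1)).mono_set Set.Ioc_subset_Icc_self

lemma integral_mul_truncated_log_mul (g : ℝ → ℝ) :
    ∫ r in Set.Ioi 0, (r * if r ≤ 1 then log (1 / r) else 0) * g r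
      = -∫ r in (0:ℝ)..1, r * log r * g r := by
  rw [intervalIntegral.integral_of_le zero_le_one, ← integral_neg,
    ← Set.inter_eq_self_of_subset_right (Set.Ioc_subset_Ioi_self (a := (1 : ℝ)) (b := 0)),
    ← setIntegral_indicator measurableSet_Ioc]
  refine setIntegral_congr_fun measurableSet_Ioi fun r hr => ?_
  have h := mul_truncated_log_eq_indicator hr
  simp only at h
  rw [h]
  by_cases h1 : r ∈ Set.Ioc (0 : ℝ) 1 <;> simp [h1]

lemma integral_mul_log_zero_one : ∫ r in (0:ℝ)..1, r * log r = -(1 / 4) := by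
  rw [intervalIntegral.integral_eq_sub_of_hasDerivAt_of_le zero_le_one
    (f := fun r => r / 2 * (r * log r) - r ^ 2 / 4)]
  · norm_num
  · have := continuous_mul_log
    exact Continuous.continuousOn (by fun_prop)
  · intro r hr
    refine ((((hasDerivAt_id r).div_const 2).mul (hasDerivAt_mul_log hr.1.ne')).sub
      ((hasDerivAt_pow 2 r).div_const 4)).congr_deriv ?_
    simp only [id]
    ring
  · exact continuous_mul_log.intervalIntegrable _ _

lemma integral_mul_log_mul_J0 {a : ℝ} (ha : a ≠ 0) :
    ∫ r in (0:ℝ)..1, r * log r * J0 (a * r) = (J0 a - 1) / a ^ 2 := by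
  have hJ1 := continuous_J1
  have hlog := continuous_mul_log
  have hJ0 := continuous_J0
  rw [intervalIntegral.integral_eq_sub_of_hasDerivAt_of_le zero_le_one
    (f := fun r => r * log r * J1 (a * r) / a + J0 (a * r) / a ^ 2)]
  · simp [J0_zero]
    ring
  · exact Continuous.continuousOn (by fun_prop)
  · intro r hr
    have hr : r ≠ 0 := hr.1.ne'
    have hlin : HasDerivAt (fun r => a * r) a r := by
      simpa using (hasDerivAt_id r).const_mul a
    have h1 := (hasDerivAt_log hr).mul ((hasDerivAt_mul_J1 (a * r)).comp r hlin)
    have h2 := (hasDerivAt_J0 (a * r)).comp r hlin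
    convert (h1.div_const (a ^ 2)).add (h2.div_const (a ^ 2)) using 1
    · ext s
      simp only [Pi.add_apply, Pi.mul_apply, Function.comp_apply]
      field_simp
    · simp only [Function.comp_apply]
      field_simp
      ring
  · exact Continuous.intervalIntegrable (by fun_prop) _ _

/-- `K₁` is integrable on `ℝ²`, its Fourier transform
`𝓕K₁(ξ) = ∫ K₁(x) e^{-2πi⟨x,ξ⟩} dx` equals `(1 - J₀(2π|ξ|)) / (2π|ξ|²)` for
`ξ ≠ 0`, and `𝓕K₁(0) = π/2`. -/
theorem statement10 :
    Integrable K1 (volume : Measure Plane) ∧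
    (∀ ξ : Plane, ξ ≠ 0 →
      𝓕 (fun x : Plane => (K1 x : ℂ)) ξ
        = (((1 - J0 (2 * π * ‖ξ‖)) / (2 * π * ‖ξ‖ ^ 2) : ℝ) : ℂ)) ∧
    𝓕 (fun x : Plane => (K1 x : ℂ)) 0 = ((π / 2 : ℝ) : ℂ) := by
  have hfourier := fourier_comp_norm_plane integrableOn_mul_truncated_log
  simp only [integral_mul_truncated_log_mul (fun r => J0 (_ * r))] at hfourier
  refine ⟨(integrable_comp_norm_plane_iff _).2 integrableOn_mul_truncated_log,
    fun ξ hξ => (hfourier ξ).trans ?_, (hfourier 0).trans ?_⟩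
  · have hξ : ‖ξ‖ ≠ 0 := norm_ne_zero_iff.2 hξ
    rw [integral_mul_log_mul_J0 (by positivity)]
    congr 1
    field_simp
    ring
  · simp only [norm_zero, mul_zero, zero_mul, J0_zero, mul_one]
    rw [integral_mul_log_zero_one]
    congr 1
    ring
end
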